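/- arXiv:0903.3753 — 2 statements merged into one kernel-verified Lean document; each statement's English description precedes it below -/
import Mathlib

section
/- Let L_n denote the lexicographically least binary de Bruijn sequence of order n. There exist constants c, C > 0 and an integer N such that for all n ≥ N, c · 2^n · log n / n ≤ disc(L_n) ≤ C · 2^n · log n / n (logarithms natural). -/
/-- All binary words of length `n` (`false` = 0, `true` = 1), listed in lexicographic order. -/
def allWords : ℕ → List (List Bool)
  | 0 => [[]]
  | n + 1 => (allWords n).flatMap (fun w => [w ++ [false], w ++ [true]])

/-- The skew of a binary word: number of 0s minus number of 1s. -/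
def skew (w : List Bool) : ℤ := (w.map (fun b => if b then (-1 : ℤ) else 1)).sum

/-- The discrepancy of a binary word: the maximum over all (nonempty) initial
segments of the absolute difference between the number of 0s and of 1s. -/
def disc (w : List Bool) : ℤ :=
  ((List.range w.length).map (fun M => |skew (w.take (M + 1))|)).foldr max 0

/-- `w` contains a run of `k` consecutive 0s. -/
def hasZeroRun (k : ℕ) (w : List Bool) : Prop := List.replicate k false <:+: w

instance (k : ℕ) : DecidablePred (hasZeroRun k) := fun _ => inferInstanceAs (Decidable (_ <:+: _))

/-- Number of binary words of length `n` containing no run of `k` consecutive 0s. -/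
def alpha (k n : ℕ) : ℕ := ((allWords n).filter (fun w => !decide (hasZeroRun k w))).length

/-- Sum of the skews of all binary words of length `n` containing no run of `k` consecutive 0s. -/
def beta (k n : ℕ) : ℤ :=
  (((allWords n).filter (fun w => !decide (hasZeroRun k w))).map skew).sum

/-- Strict lexicographic order on binary words, with 0 < 1. -/
def lexLt (u v : List Bool) : Prop := List.Lex (· < ·) u v

instance : DecidableRel lexLt := fun _ _ => inferInstanceAs (Decidable (List.Lex _ _ _))

/-- Weak lexicographic order on binary words. -/
def lexLe (u v : List Bool) : Prop := lexLt u v ∨ u = v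

instance : DecidableRel lexLe := fun _ _ => inferInstanceAs (Decidable (_ ∨ _))

/-- A binary Lyndon word: nonempty and strictly lexicographically smaller than
each of its nontrivial cyclic rotations. -/
def IsLyndon (w : List Bool) : Prop :=
  w ≠ [] ∧ ∀ i ∈ Finset.Ico 1 w.length, lexLt w (w.rotate i)

instance : DecidablePred IsLyndon := fun _ => inferInstanceAs (Decidable (_ ∧ _))

/-- `ell n k`: the concatenation, in lexicographic order, of all binary Lyndon words of
length `n` whose longest run of consecutive 0s has length exactly `k`. -/
def ell (n k : ℕ) : List Bool :=
  (List.insertionSort lexLe ((allWords n).filter (fun w =>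
    decide (IsLyndon w) && decide (hasZeroRun k w) && !decide (hasZeroRun (k + 1) w)))).flatten

/-- `LWord n`: the lexicographically least binary de Bruijn sequence of order `n`, i.e. the
concatenation, in lexicographic order, of all binary Lyndon words of length dividing `n`. -/
def LWord (n : ℕ) : List Bool :=
  (List.insertionSort lexLe (((List.range (n + 1)).flatMap allWords).filter
    (fun w => decide (IsLyndon w) && decide (w.length ∣ n)))).flatten

/-- The number of occurrences of `0^k` as a subword of `w`. -/
def occCount (k : ℕ) (w : List Bool) : ℕ :=
  ((List.range (w.length + 1)).filter
    (fun i => decide (List.replicate k false <+: w.drop i))).length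


section Words

theorem mem_allWords {n : ℕ} {w : List Bool} : w ∈ allWords n ↔ w.length = n := by
  induction n generalizing w with
  | zero => simp [allWords]
  | succ n ih =>
    simp only [allWords, List.mem_flatMap, ih]
    constructor
    · rintro ⟨v, hv, h⟩
      simp only [List.mem_cons, List.not_mem_nil, or_false] at h
      rcases h with rfl | rfl <;> simp [hv]
    · intro h
      have hne : w ≠ [] := by rintro rfl; simp at h
      refine ⟨w.dropLast, by simp [h], ?_⟩
      have := List.dropLast_append_getLast hne
      cases hb : w.getLast hne <;> rw [hb] at this <;> simp [this]

theorem nodup_allWords (n : ℕ) : (allWords n).Nodup := by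
  induction n with
  | zero => simp [allWords]
  | succ n ih =>
    rw [allWords, List.nodup_flatMap]
    refine ⟨fun w _ => by simp, ih.imp ?_⟩
    intro u v huv
    simp only [Function.onFun]
    intro x hx hy
    simp only [List.mem_cons, List.not_mem_nil, or_false] at hx hy
    rcases hx with rfl | rfl <;> rcases hy with h | h <;> simp_all

/-- The set of binary words of length `n`. -/
def wordFinset (n : ℕ) : Finset (List Bool) := (allWords n).toFinset

@[simp]
theorem mem_wordFinset {n : ℕ} {w : List Bool} : w ∈ wordFinset n ↔ w.length = n := by
  simp [wordFinset, mem_allWords]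

theorem wordFinset_succ (n : ℕ) :
    wordFinset (n + 1) =
      (wordFinset n).image (List.cons false) ∪ (wordFinset n).image (List.cons true) := by
  ext w
  rcases w with _ | ⟨b, v⟩
  · simp
  · cases b <;> simp

theorem disjoint_image_cons (s t : Finset (List Bool)) :
    Disjoint (s.image (List.cons false)) (t.image (List.cons true)) := by
  rw [Finset.disjoint_left]
  intro w hw hw'
  simp only [Finset.mem_image] at hw hw'
  obtain ⟨u, -, rfl⟩ := hw
  obtain ⟨v, -, h⟩ := hw'
  simp at h

theorem sum_wordFinset_succ {M : Type*} [AddCommMonoid M] (n : ℕ) (f : List Bool → M) :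
    ∑ w ∈ wordFinset (n + 1), f w = ∑ v ∈ wordFinset n, (f (false :: v) + f (true :: v)) := by
  rw [wordFinset_succ, Finset.sum_union (disjoint_image_cons _ _),
    Finset.sum_image (by simp), Finset.sum_image (by simp), Finset.sum_add_distrib]

theorem card_wordFinset (n : ℕ) : (wordFinset n).card = 2 ^ n := by
  induction n with
  | zero => rfl
  | succ n ih =>
    rw [Finset.card_eq_sum_ones, sum_wordFinset_succ]
    simp [ih, pow_succ]

theorem skew_append (u v : List Bool) : skew (u ++ v) = skew u + skew v := by
  simp [skew]

theorem skew_cons (b : Bool) (v : List Bool) :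
    skew (b :: v) = (if b then -1 else 1) + skew v := by
  simp [skew]

theorem skew_flatten (l : List (List Bool)) : skew l.flatten = (l.map skew).sum := by
  induction l with
  | nil => rfl
  | cons a l ih => simp [skew_append, ih]

theorem abs_skew_le (w : List Bool) : |skew w| ≤ w.length := by
  induction w with
  | nil => simp [skew]
  | cons b v ih =>
    rw [skew_cons, List.length_cons]
    rw [abs_le] at ih ⊢
    push_cast
    cases b <;> simp <;> constructor <;> linarith [ih.1, ih.2]

theorem skew_eq_of_isRotated {u v : List Bool} (h : u ~r v) : skew u = skew v :=
  (h.perm.map _).sum_eq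

theorem skew_eq_sum_rotate (w : List Bool) :
    skew w = ∑ i ∈ Finset.range w.length,
      if (w.rotate i).head? = some true then (-1 : ℤ) else 1 := by
  have key : ∀ u : List Bool,
      skew u = ∑ i ∈ Finset.range u.length, if u[i]? = some true then (-1 : ℤ) else 1 := by
    intro u
    induction u with
    | nil => rfl
    | cons b v ih =>
      rw [skew_cons, List.length_cons, Finset.sum_range_succ', ih, add_comm]
      simp
  rw [key]
  refine Finset.sum_congr rfl fun i hi => ?_
  rw [List.head?_rotate (Finset.mem_range.1 hi)]

theorem isRotated_cons_iff {x : Bool} {u v : List Bool} :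
    u ~r x :: v ↔ ∃ a b, v = a ++ b ∧ u = b ++ x :: a := by
  constructor
  · intro h
    obtain ⟨i, hi, rfl⟩ := List.isRotated_iff_mod.1 h.symm
    rw [List.rotate_eq_drop_append_take hi]
    rcases i with _ | i
    · exact ⟨v, [], by simp, by simp⟩
    · exact ⟨v.take i, v.drop i, by simp, by simp⟩
  · rintro ⟨a, b, rfl, rfl⟩
    exact List.isRotated_append

theorem lt_of_flip (a b : List Bool) : b ++ false :: a < b ++ true :: a := by
  induction b with
  | nil => simp [List.cons_lt_cons_iff]
  | cons x b ih => simpa [List.cons_lt_cons_iff] using ih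

end Words

section Pivotal

open scoped Classical in
/-- The words `v` of length `n` for which prepending `0` gives a word satisfying `B` while
prepending `1` does not. -/
noncomputable def pivotal (B : List Bool → Prop) (n : ℕ) : Finset (List Bool) :=
  {v ∈ wordFinset n | B (false :: v) ∧ ¬ B (true :: v)}

open scoped Classical in
/-- For a rotation-invariant family which is stable under replacing the first `1` by `0`, the
total skew is counted by the pivotal words. -/
theorem sum_skew_eq_card_pivotal (B : List Bool → Prop) (n : ℕ)
    (hrot : ∀ u v, u ~r v → B u → B v) (hdown : ∀ v, B (true :: v) → B (false :: v)) :
    ∑ w ∈ wordFinset (n + 1) with B w, skew w = (n + 1) * ((pivotal B n).card : ℤ) := by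
  have h1 : ∑ w ∈ wordFinset (n + 1) with B w, skew w =
      ∑ i ∈ Finset.range (n + 1), ∑ w ∈ wordFinset (n + 1) with B w,
        if (w.rotate i).head? = some true then (-1 : ℤ) else 1 := by
    rw [Finset.sum_comm]
    refine Finset.sum_congr rfl fun w hw => ?_
    rw [skew_eq_sum_rotate, mem_wordFinset.1 (Finset.mem_filter.1 hw).1]
  have h2 : ∀ i ∈ Finset.range (n + 1), (∑ w ∈ wordFinset (n + 1) with B w,
        if (w.rotate i).head? = some true then (-1 : ℤ) else 1) = (pivotal B n).card := by
    intro i hi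
    have h3 : (∑ w ∈ wordFinset (n + 1) with B w,
        if (w.rotate i).head? = some true then (-1 : ℤ) else 1) =
        ∑ w ∈ wordFinset (n + 1) with B w, if w.head? = some true then (-1 : ℤ) else 1 := by
      refine Finset.sum_nbij (fun w => w.rotate i) ?_ ?_ ?_ ?_
      · intro w hw
        simp only [Finset.mem_filter, mem_wordFinset, List.length_rotate] at hw ⊢
        exact ⟨hw.1, hrot _ _ ⟨i, rfl⟩ hw.2⟩
      · intro u _ v _ h
        exact List.rotate_injective i h
      · intro w hw
        simp only [Finset.coe_filter, mem_wordFinset, Set.mem_ofPred_eq, Set.mem_image] at hw ⊢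
        refine ⟨w.rotate (n + 1 - i), ⟨by simp [hw.1], hrot _ _ ⟨_, rfl⟩ hw.2⟩, ?_⟩
        rw [List.rotate_rotate, Nat.sub_add_cancel (Finset.mem_range.1 hi).le, ← hw.1,
          List.rotate_length]
      · intro w _
        rfl
    rw [h3, Finset.sum_filter, sum_wordFinset_succ, pivotal, Finset.card_filter, Nat.cast_sum]
    refine Finset.sum_congr rfl fun v _ => ?_
    have := hdown v
    by_cases hb : B (true :: v)
    · simp [hb, this hb]
    · by_cases hb' : B (false :: v) <;> simp [hb, hb']
  rw [h1, Finset.sum_congr rfl h2]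
  simp

/-- Some rotation of `w` is lexicographically at most `t`. -/
def HasRotationLE (t w : List Bool) : Prop := ∃ u, u ~r w ∧ u ≤ t

theorem HasRotationLE.of_isRotated {t u v : List Bool} (h : u ~r v) (hu : HasRotationLE t u) :
    HasRotationLE t v := by
  obtain ⟨x, hx, hxt⟩ := hu
  exact ⟨x, hx.trans h, hxt⟩

theorem hasRotationLE_cons_iff {t v : List Bool} {x : Bool} :
    HasRotationLE t (x :: v) ↔ ∃ a b, v = a ++ b ∧ b ++ x :: a ≤ t := by
  constructor
  · rintro ⟨u, hu, hut⟩
    obtain ⟨a, b, rfl, rfl⟩ := isRotated_cons_iff.1 hu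
    exact ⟨a, b, rfl, hut⟩
  · rintro ⟨a, b, rfl, h⟩
    exact ⟨_, isRotated_cons_iff.2 ⟨a, b, rfl, rfl⟩, h⟩

theorem HasRotationLE.flip {t v : List Bool} (h : HasRotationLE t (true :: v)) :
    HasRotationLE t (false :: v) := by
  rw [hasRotationLE_cons_iff] at h ⊢
  obtain ⟨a, b, rfl, h⟩ := h
  exact ⟨a, b, rfl, (lt_of_flip a b).le.trans h⟩

open scoped Classical in
theorem sum_skew_hasRotationLE (t : List Bool) (n : ℕ) :
    ∑ w ∈ wordFinset (n + 1) with HasRotationLE t w, skew w =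
      (n + 1) * ((pivotal (HasRotationLE t) n).card : ℤ) :=
  sum_skew_eq_card_pivotal _ n (fun _ _ => HasRotationLE.of_isRotated) fun _ => HasRotationLE.flip

end Pivotal

section Lyndon

theorem IsLyndon.le_of_isRotated {w u : List Bool} (hw : IsLyndon w) (h : w ~r u) : w ≤ u := by
  obtain ⟨i, hi, rfl⟩ := List.isRotated_iff_mod.1 h
  rcases Nat.eq_zero_or_pos i with rfl | hpos
  · simp
  rcases hi.lt_or_eq with hlt | rfl
  · exact le_of_lt (hw.2 i (Finset.mem_Ico.2 ⟨hpos, hlt⟩))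
  · simp

theorem IsLyndon.eq_of_isRotated {w u : List Bool} (hw : IsLyndon w) (hu : IsLyndon u)
    (h : w ~r u) : w = u :=
  le_antisymm (hw.le_of_isRotated h) (hu.le_of_isRotated h.symm)

theorem IsLyndon.rotate_injOn {w : List Bool} (hw : IsLyndon w) {i j : ℕ} (hi : i < w.length)
    (hj : j < w.length) (h : w.rotate i = w.rotate j) : i = j := by
  wlog hij : i < j generalizing i j
  · rcases lt_trichotomy i j with h' | h' | h'
    · exact absurd h' hij
    · exact h'
    · exact (this hj hi h.symm h').symm
  exfalso
  have h1 : w.rotate (j - i) = w := by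
    apply List.rotate_injective i
    simp only [List.rotate_rotate]
    rw [Nat.sub_add_cancel hij.le, h]
  have h2 := hw.2 (j - i) (Finset.mem_Ico.2 ⟨by omega, by omega⟩)
  rw [h1] at h2
  exact lt_irrefl w h2

open scoped Classical in
theorem length_mul_sum_skew_lyndon (t : List Bool) (n : ℕ) :
    (n : ℤ) * ∑ w ∈ wordFinset n with IsLyndon w ∧ w ≤ t, skew w =
      ∑ w ∈ wordFinset n with ∃ u, IsLyndon u ∧ u ≤ t ∧ u ~r w, skew w := by
  have h : ∑ p ∈ (wordFinset n).filter (fun w => IsLyndon w ∧ w ≤ t) ×ˢ Finset.range n,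
      skew p.1 = ∑ w ∈ wordFinset n with ∃ u, IsLyndon u ∧ u ≤ t ∧ u ~r w, skew w := by
    refine Finset.sum_nbij (fun p => p.1.rotate p.2) ?_ ?_ ?_ ?_
    · rintro ⟨w, i⟩ hw
      simp only [Finset.mem_product, Finset.mem_filter, mem_wordFinset, Finset.mem_range,
        List.length_rotate] at hw ⊢
      exact ⟨hw.1.1, w, hw.1.2.1, hw.1.2.2, i, rfl⟩
    · rintro ⟨w, i⟩ hw ⟨u, j⟩ hu h
      simp only [Finset.coe_product, Finset.coe_filter, mem_wordFinset, Set.mem_prod,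
        Set.mem_ofPred_eq, Finset.coe_range, Set.mem_Iio] at hw hu h
      obtain rfl : w = u := hw.1.2.1.eq_of_isRotated hu.1.2.1
        ((show w ~r w.rotate i from ⟨i, rfl⟩).trans (h ▸ (show u ~r u.rotate j from ⟨j, rfl⟩).symm))
      rw [hw.1.2.1.rotate_injOn (by omega) (by omega) h]
    · intro w hw
      simp only [Finset.coe_filter, mem_wordFinset, Set.mem_ofPred_eq] at hw
      obtain ⟨hlen, u, hu, hut, huw⟩ := hw
      have hul : u.length = n := huw.perm.length_eq.trans hlen
      obtain ⟨i, rfl⟩ := huw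
      have hpos : 0 < u.length := List.length_pos_of_ne_nil hu.1
      refine ⟨(u, i % u.length), ?_, List.rotate_mod u i⟩
      simp only [Finset.coe_product, Finset.coe_filter, mem_wordFinset, Set.mem_prod,
        Set.mem_ofPred_eq, Finset.coe_range, Set.mem_Iio]
      exact ⟨⟨hul, hu, hut⟩, hul ▸ Nat.mod_lt _ hpos⟩
    · rintro ⟨w, i⟩ _
      exact skew_eq_of_isRotated ⟨i, rfl⟩
  rw [← h, Finset.sum_product, Finset.mul_sum]
  simp

open scoped Classical in
/-- The words of length `n` fixed by some nontrivial rotation. -/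
noncomputable def imprimitive (n : ℕ) : Finset (List Bool) :=
  {w ∈ wordFinset n | ∃ i ∈ Finset.Ico 1 n, w.rotate i = w}

theorem exists_isRotated_forall_le (w : List Bool) :
    ∃ u, w ~r u ∧ ∀ v, w ~r v → u ≤ v := by
  obtain ⟨u, hu, hmin⟩ := Finset.exists_min_image
    ((Finset.range (w.length + 1)).image w.rotate) id ⟨_, Finset.mem_image_of_mem _
      (Finset.mem_range.2 (Nat.succ_pos _))⟩
  simp only [Finset.mem_image, Finset.mem_range] at hu
  obtain ⟨i, -, rfl⟩ := hu
  refine ⟨_, ⟨i, rfl⟩, fun v hv => ?_⟩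
  obtain ⟨j, hj, rfl⟩ := List.isRotated_iff_mod.1 hv
  exact hmin _ (Finset.mem_image_of_mem _ (Finset.mem_range.2 (Nat.lt_succ_of_le hj)))

theorem exists_lyndon_or_mem_imprimitive {t w : List Bool} {n : ℕ} (hn : 0 < n)
    (hw : w ∈ wordFinset n) (h : HasRotationLE t w) :
    (∃ u, IsLyndon u ∧ u ≤ t ∧ u ~r w) ∨ w ∈ imprimitive n := by
  rw [mem_wordFinset] at hw
  obtain ⟨u, hwu, hmin⟩ := exists_isRotated_forall_le w
  obtain ⟨x, hx, hxt⟩ := h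
  have hul : u.length = n := hwu.perm.length_eq.symm.trans hw
  by_cases hu : IsLyndon u
  · exact Or.inl ⟨u, hu, (hmin x hx.symm).trans hxt, hwu.symm⟩
  right
  have hne : u ≠ [] := by rintro rfl; simp at hul; omega
  simp only [IsLyndon, not_and, not_forall] at hu
  obtain ⟨i, hi, hlt⟩ := hu hne
  have hle : u.rotate i ≤ u := not_lt.1 hlt
  have heq : u.rotate i = u := le_antisymm hle (hmin _ (hwu.trans ⟨i, rfl⟩))
  obtain ⟨j, rfl⟩ := hwu.symm
  simp only [imprimitive, Finset.mem_filter, mem_wordFinset]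
  refine ⟨by simpa using hul, i, hul ▸ hi, ?_⟩
  rw [List.rotate_rotate, add_comm, ← List.rotate_rotate, heq]

open scoped Classical in
theorem abs_sum_lyndon_sub_card_pivotal_le (t : List Bool) (n : ℕ) :
    |∑ w ∈ wordFinset (n + 1) with IsLyndon w ∧ w ≤ t, skew w -
      ((pivotal (HasRotationLE t) n).card : ℤ)| ≤ (imprimitive (n + 1)).card := by
  have hsub : {w ∈ wordFinset (n + 1) | ∃ u, IsLyndon u ∧ u ≤ t ∧ u ~r w} ⊆
      {w ∈ wordFinset (n + 1) | HasRotationLE t w} := by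
    intro w hw
    rw [Finset.mem_filter] at hw ⊢
    obtain ⟨hw, u, -, hut, huw⟩ := hw
    exact ⟨hw, u, huw, hut⟩
  have h1 := Finset.sum_sdiff hsub (f := skew)
  rw [sum_skew_hasRotationLE, ← length_mul_sum_skew_lyndon] at h1
  set X := {w ∈ wordFinset (n + 1) | HasRotationLE t w} \
    {w ∈ wordFinset (n + 1) | ∃ u, IsLyndon u ∧ u ≤ t ∧ u ~r w} with hX
  have hXs : X ⊆ imprimitive (n + 1) := by
    intro w hw
    simp only [hX, Finset.mem_sdiff, Finset.mem_filter, not_and] at hw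
    exact (exists_lyndon_or_mem_imprimitive (Nat.succ_pos n) hw.1.1 hw.1.2).resolve_left
      (hw.2 hw.1.1)
  have h2 : |∑ w ∈ X, skew w| ≤ (n + 1) * (imprimitive (n + 1)).card := by
    calc |∑ w ∈ X, skew w| ≤ ∑ w ∈ X, |skew w| := Finset.abs_sum_le_sum_abs _ _
      _ ≤ ∑ w ∈ X, ((n : ℤ) + 1) := by
        refine Finset.sum_le_sum fun w hw => ?_
        have := abs_skew_le w
        have hl : w.length = n + 1 := by
          have := hXs hw
          simp only [imprimitive, Finset.mem_filter, mem_wordFinset] at this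
          exact this.1
        rw [hl] at this
        exact_mod_cast this
      _ = (n + 1) * (X.card : ℤ) := by simp [mul_comm]
      _ ≤ (n + 1) * (imprimitive (n + 1)).card := by gcongr
  have hpos : (0 : ℤ) < n + 1 := by positivity
  push_cast at h1
  refine le_of_mul_le_mul_left ?_ hpos
  refine le_trans (le_of_eq ?_) h2
  have h3 : ((n : ℤ) + 1) * (∑ w ∈ wordFinset (n + 1) with IsLyndon w ∧ w ≤ t, skew w -
      ((pivotal (HasRotationLE t) n).card : ℤ)) = -∑ w ∈ X, skew w := by linarith
  rw [← abs_neg (∑ w ∈ X, skew w), ← h3, abs_mul, abs_of_pos hpos]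

theorem eq_of_prefix_append {a u v : List Bool} (ha : a ≠ []) (hl : u.length = v.length)
    (hu : u <+: a ++ u) (hv : v <+: a ++ v) : u = v := by
  have ha : 0 < a.length := List.length_pos_of_ne_nil ha
  refine List.ext_getElem hl fun i => ?_
  induction i using Nat.strong_induction_on with
  | _ i ih =>
    intro h1 h2
    rw [hu.getElem h1, hv.getElem h2]
    by_cases h : i < a.length
    · rw [List.getElem_append_left h, List.getElem_append_left h]
    · rw [List.getElem_append_right (by omega), List.getElem_append_right (by omega)]
      exact ih _ (by omega) (by omega) (by omega)

theorem card_rotate_eq_self_le {n i : ℕ} (hi : 0 < i) (hin : i ≤ n) :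
    {w ∈ wordFinset n | w.rotate i = w}.card ≤ 2 ^ i := by
  rw [← card_wordFinset i]
  refine Finset.card_le_card_of_injOn (List.take i) ?_ ?_
  · intro w hw
    simp only [Finset.coe_filter, mem_wordFinset, Set.mem_ofPred_eq] at hw
    simp [hw.1, hin]
  · have key : ∀ w : List Bool, w.length = n → w.rotate i = w → w <+: w.take i ++ w := by
      intro w hl hw
      rw [List.rotate_eq_drop_append_take (hl ▸ hin)] at hw
      refine ⟨w.take i, ?_⟩
      nth_rewrite 1 [← List.take_append_drop i w]
      rw [List.append_assoc, hw]
    intro u hu v hv h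
    simp only [Finset.coe_filter, mem_wordFinset, Set.mem_ofPred_eq] at hu hv h
    refine eq_of_prefix_append (a := u.take i) ?_ (hu.1.trans hv.1.symm) (key u hu.1 hu.2) ?_
    · rw [← List.length_pos_iff]
      simp [hu.1]; omega
    · rw [h]
      exact key v hv.1 hv.2

theorem card_imprimitive_le (n : ℕ) : (imprimitive n).card ≤ 2 ^ (n / 2 + 1) := by
  have hsub : imprimitive n ⊆ (Finset.Ico 1 (n / 2 + 1)).biUnion
      fun i => {w ∈ wordFinset n | w.rotate i = w} := by
    intro w hw
    simp only [imprimitive, Finset.mem_filter, mem_wordFinset, Finset.mem_Ico] at hw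
    obtain ⟨hl, i, hi, h⟩ := hw
    simp only [Finset.mem_biUnion, Finset.mem_Ico, Finset.mem_filter, mem_wordFinset]
    by_cases h2 : i ≤ n / 2
    · exact ⟨i, by omega, hl, h⟩
    · refine ⟨n - i, by omega, hl, List.rotate_injective i ?_⟩
      simp only [List.rotate_rotate]
      rw [Nat.sub_add_cancel hi.2.le, h, ← hl, List.rotate_length]
  calc (imprimitive n).card ≤ _ := Finset.card_le_card hsub
    _ ≤ ∑ i ∈ Finset.Ico 1 (n / 2 + 1), {w ∈ wordFinset n | w.rotate i = w}.card :=
      Finset.card_biUnion_le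
    _ ≤ ∑ i ∈ Finset.Ico 1 (n / 2 + 1), 2 ^ i := by
      refine Finset.sum_le_sum fun i hi => ?_
      rw [Finset.mem_Ico] at hi
      exact card_rotate_eq_self_le (by omega) (by omega)
    _ ≤ ∑ i ∈ Finset.range (n / 2 + 1), 2 ^ i :=
      Finset.sum_le_sum_of_subset (by intro i; simp)
    _ ≤ 2 ^ (n / 2 + 1) := by
      have := Nat.geomSum_lt (m := 2) (n := n / 2 + 1) (s := Finset.range (n / 2 + 1)) le_rfl
        (by simp)
      exact this.le

end Lyndon

section ZeroRuns

theorem hasZeroRun.le_length {k : ℕ} {w : List Bool} (h : hasZeroRun k w) : k ≤ w.length := by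
  simpa using List.IsInfix.length_le h

theorem replicate_false_prefix_append_true_iff {k : ℕ} {x y : List Bool} :
    List.replicate k false <+: x ++ true :: y ↔ List.replicate k false <+: x := by
  induction x generalizing k with
  | nil => rcases k with _ | k <;> simp [List.replicate_succ]
  | cons c x ih => rcases k with _ | k <;> simp [List.replicate_succ, ih]

theorem hasZeroRun_append_true_iff {k : ℕ} {x y : List Bool} :
    hasZeroRun k (x ++ true :: y) ↔ hasZeroRun k x ∨ hasZeroRun k y := by
  induction x with
  | nil =>
    rcases k with _ | k <;> simp [hasZeroRun, List.infix_cons_iff, List.replicate_succ]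
  | cons c x ih =>
    have := replicate_false_prefix_append_true_iff (k := k) (x := c :: x) (y := y)
    simp only [hasZeroRun, List.cons_append, List.infix_cons_iff] at this ih ⊢
    rw [this, ih, or_assoc]

theorem hasZeroRun_cons_true {k : ℕ} {v : List Bool} :
    hasZeroRun (k + 1) (true :: v) ↔ hasZeroRun (k + 1) v := by
  simp [hasZeroRun, List.infix_cons_iff, List.replicate_succ]

theorem hasZeroRun_cons_false {k : ℕ} {v : List Bool} :
    hasZeroRun (k + 1) (false :: v) ↔ List.replicate k false <+: v ∨ hasZeroRun (k + 1) v := by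
  simp [hasZeroRun, List.infix_cons_iff, List.replicate_succ]

/-- The words of length `n` without a run of `k` consecutive zeros. -/
def avoiding (k n : ℕ) : Finset (List Bool) := {w ∈ wordFinset n | ¬ hasZeroRun k w}

theorem mem_avoiding {k n : ℕ} {w : List Bool} :
    w ∈ avoiding k n ↔ w.length = n ∧ ¬ hasZeroRun k w := by
  simp [avoiding]

theorem card_avoiding_le (k n : ℕ) : (avoiding k n).card ≤ 2 ^ n :=
  card_wordFinset n ▸ Finset.card_filter_le _ _

theorem card_avoiding_succ (k n : ℕ) :
    (avoiding (k + 1) (n + 1)).card +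
      {v ∈ avoiding (k + 1) n | List.replicate k false <+: v}.card =
    2 * (avoiding (k + 1) n).card := by
  simp only [avoiding, Finset.filter_filter, Finset.card_filter]
  rw [sum_wordFinset_succ, ← Finset.sum_add_distrib, Finset.mul_sum]
  refine Finset.sum_congr rfl fun v _ => ?_
  simp only [hasZeroRun_cons_true, hasZeroRun_cons_false]
  by_cases h1 : hasZeroRun (k + 1) v <;> by_cases h2 : List.replicate k false <+: v <;>
    simp [h1, h2]

theorem not_hasZeroRun_replicate_append {k j : ℕ} {z : List Bool} (hj : j < k)
    (hz : ¬ hasZeroRun k z) : ¬ hasZeroRun k (List.replicate j false ++ true :: z) := by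
  rw [hasZeroRun_append_true_iff, not_or]
  refine ⟨fun h => ?_, hz⟩
  have := h.le_length
  simp at this
  omega

theorem card_avoiding_recurrence (k m : ℕ) :
    (avoiding (k + 1) (k + 1 + m + 1)).card + (avoiding (k + 1) m).card =
      2 * (avoiding (k + 1) (k + 1 + m)).card := by
  rw [← card_avoiding_succ, Nat.add_left_cancel_iff]
  refine Finset.card_nbij (fun z => List.replicate k false ++ true :: z) ?_ ?_ ?_
  · intro z hz
    simp only [Finset.coe_filter, mem_avoiding, Set.mem_ofPred_eq, Finset.mem_coe] at hz ⊢
    refine ⟨⟨by simp [hz.1]; omega, not_hasZeroRun_replicate_append (by omega) hz.2⟩, by simp⟩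
  · intro u _ v _ h
    simpa using h
  · intro w hw
    simp only [Finset.coe_filter, mem_avoiding, Set.mem_ofPred_eq, Set.mem_image,
      Finset.mem_coe] at hw ⊢
    obtain ⟨⟨hl, hw⟩, z, rfl⟩ := hw
    rcases z with _ | ⟨c, z⟩
    · simp at hl; omega
    cases c
    · refine absurd ⟨[], z, ?_⟩ hw
      simp [List.replicate_succ']
    · rw [hasZeroRun_append_true_iff, not_or] at hw
      exact ⟨z, ⟨by simp at hl; omega, hw.2⟩, rfl⟩

theorem card_avoiding_add_le (k m j : ℕ) :
    (avoiding (k + 1) (m + j)).card ≤ 2 ^ j * (avoiding (k + 1) m).card := by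
  induction j with
  | zero => simp
  | succ j ih =>
    have := card_avoiding_succ k (m + j)
    rw [pow_succ, ← add_assoc]
    linarith

theorem card_avoiding_le_mul_pow (k m : ℕ) :
    ((avoiding (k + 1) (k + 1 + m)).card : ℝ) ≤
      2 ^ (k + 1 + m) * (1 - 1 / 2 ^ (k + 2)) ^ m := by
  induction m with
  | zero => simpa using mod_cast card_avoiding_le (k + 1) (k + 1)
  | succ m ih =>
    have h1 : ((avoiding (k + 1) (k + 1 + m + 1)).card : ℝ) + (avoiding (k + 1) m).card =
      2 * (avoiding (k + 1) (k + 1 + m)).card := mod_cast card_avoiding_recurrence k m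
    have h2 : ((avoiding (k + 1) (k + 1 + m)).card : ℝ) ≤
        2 ^ (k + 1) * (avoiding (k + 1) m).card := by
      rw [add_comm (k + 1) m]
      exact_mod_cast card_avoiding_add_le k m (k + 1)
    have hp : (0 : ℝ) < 2 ^ (k + 2) := by positivity
    have h3 : (1 : ℝ) / 2 ^ (k + 2) ≤ 1 := by
      rw [div_le_one hp]
      exact one_le_pow₀ (by norm_num)
    have h4 : ((avoiding (k + 1) (k + 1 + m)).card : ℝ) / 2 ^ (k + 1) ≤
        (avoiding (k + 1) m).card := by
      rw [div_le_iff₀ (by positivity)]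
      linarith
    calc ((avoiding (k + 1) (k + 1 + m + 1)).card : ℝ)
        ≤ (2 * (1 - 1 / 2 ^ (k + 2))) * (avoiding (k + 1) (k + 1 + m)).card := by
          have : (2 * (1 - 1 / 2 ^ (k + 2))) * ((avoiding (k + 1) (k + 1 + m)).card : ℝ) =
            2 * (avoiding (k + 1) (k + 1 + m)).card -
              (avoiding (k + 1) (k + 1 + m)).card / 2 ^ (k + 1) := by
            field_simp
            ring
          rw [this]
          linarith
      _ ≤ (2 * (1 - 1 / 2 ^ (k + 2))) * (2 ^ (k + 1 + m) * (1 - 1 / 2 ^ (k + 2)) ^ m) := by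
          refine mul_le_mul_of_nonneg_left ih ?_
          linarith
      _ = _ := by ring

theorem card_prefix_mul_le (k n : ℕ) :
    {v ∈ wordFinset n | List.replicate k false <+: v}.card * 2 ^ k ≤ 2 ^ n := by
  by_cases h : k ≤ n
  · have : {v ∈ wordFinset n | List.replicate k false <+: v}.card ≤ 2 ^ (n - k) := by
      rw [← card_wordFinset (n - k)]
      refine Finset.card_le_card_of_injOn (List.drop k) ?_ ?_
      · intro v hv
        simp only [Finset.coe_filter, mem_wordFinset, Set.mem_ofPred_eq] at hv
        simp [hv.1]
      · intro u hu v hv h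
        simp only [Finset.coe_filter, mem_wordFinset, Set.mem_ofPred_eq] at hu hv h
        obtain ⟨-, x, rfl⟩ := hu
        obtain ⟨-, y, rfl⟩ := hv
        simpa using h
    calc _ ≤ 2 ^ (n - k) * 2 ^ k := Nat.mul_le_mul_right _ this
      _ = 2 ^ n := by rw [← pow_add, Nat.sub_add_cancel h]
  · rw [Finset.filter_eq_empty_iff.2]
    · simp
    · intro v hv hp
      have := hp.length_le
      simp [mem_wordFinset.1 hv] at this
      omega

theorem two_pow_mul_le_card_avoiding (k n : ℕ) :
    2 ^ (k + 1) * 2 ^ n ≤ 2 ^ (k + 1) * (avoiding (k + 1) n).card + n * 2 ^ n := by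
  induction n with
  | zero =>
    have : avoiding (k + 1) 0 = {[]} := by
      ext w
      simp only [mem_avoiding, List.length_eq_zero_iff, Finset.mem_singleton,
        and_iff_left_iff_imp]
      rintro rfl h
      simpa using h.le_length
    simp [this]
  | succ n ih =>
    have h1 := card_avoiding_succ k n
    have h2 : {v ∈ avoiding (k + 1) n | List.replicate k false <+: v}.card * 2 ^ k ≤ 2 ^ n := by
      refine le_trans (Nat.mul_le_mul_right _ (Finset.card_le_card ?_)) (card_prefix_mul_le k n)
      exact Finset.filter_subset_filter _ (Finset.filter_subset _ _)
    have h3 := congrArg (2 ^ (k + 1) * ·) h1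
    beta_reduce at h3
    ring_nf at ih h2 h3 ⊢
    nlinarith

end ZeroRuns

section PivotalBounds

theorem cons_le_cons_iff_of_bool {c d : Bool} {u v : List Bool} :
    c :: u ≤ d :: v ↔ c < d ∨ c = d ∧ u ≤ v := by
  rw [le_iff_lt_or_eq, le_iff_lt_or_eq, List.cons_lt_cons_iff, List.cons.injEq]
  tauto

theorem not_cons_le_nil (c : Bool) (u : List Bool) : ¬ c :: u ≤ [] :=
  not_le.2 List.Lex.nil

theorem prefix_of_le_of_lt {a b t : List Bool} (h1 : b ++ false :: a ≤ t)
    (h2 : ¬ b ++ true :: a ≤ t) : b <+: t := by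
  induction b generalizing t with
  | nil => exact List.prefix_append [] _
  | cons c b ih =>
    rcases t with _ | ⟨d, t⟩
    · exact absurd h1 (not_cons_le_nil _ _)
    · simp only [List.cons_append, cons_le_cons_iff_of_bool, not_or, not_and] at h1 h2
      rcases h1 with h1 | ⟨rfl, h1⟩
      · exact absurd h1 h2.1
      · exact (List.cons_prefix_cons).2 ⟨rfl, ih h1 (h2.2 rfl)⟩

theorem exists_leading_zeros (t : List Bool) :
    ∃ m ≤ t.length, (∀ u, u.length = t.length → u ≤ t → List.replicate m false <+: u) ∧
      ∀ u, u.length = t.length → List.replicate (m + 1) false <+: u → u ≤ t := by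
  induction t with
  | nil =>
    refine ⟨0, le_rfl, fun u _ _ => List.prefix_append [] _, fun u hu _ => ?_⟩
    rw [List.length_nil, List.length_eq_zero_iff] at hu
    rw [hu]
  | cons c t ih =>
    cases c
    · obtain ⟨m, hm, h1, h2⟩ := ih
      refine ⟨m + 1, by simpa using hm, ?_, ?_⟩
      · rintro (_ | ⟨d, u⟩) hu hut
        · simp at hu
        · simp only [List.length_cons, Nat.add_right_cancel_iff] at hu
          simp only [cons_le_cons_iff_of_bool] at hut
          rcases hut with hd | ⟨rfl, hut⟩
          · exact absurd hd (by simp)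
          · simpa [List.replicate_succ] using h1 u hu hut
      · rintro (_ | ⟨d, u⟩) hu hut
        · simp at hu
        · rw [List.replicate_succ, List.cons_prefix_cons] at hut
          obtain ⟨rfl, hut⟩ := hut
          simp only [List.length_cons, Nat.add_right_cancel_iff] at hu
          exact cons_le_cons_iff_of_bool.2 (Or.inr ⟨rfl, h2 u hu hut⟩)
    · refine ⟨0, Nat.zero_le _, fun u _ _ => List.prefix_append [] _, ?_⟩
      rintro (_ | ⟨d, u⟩) hu hut
      · simp at hu
      · rw [List.replicate_succ, List.cons_prefix_cons] at hut
        obtain ⟨rfl, hut⟩ := hut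
        exact cons_le_cons_iff_of_bool.2 (Or.inl (by simp))

theorem le_replicate_append_iff (k j : ℕ) (u : List Bool) (hu : u.length = k + j) :
    u ≤ List.replicate k false ++ List.replicate j true ↔ List.replicate k false <+: u := by
  induction k generalizing u with
  | zero =>
    refine iff_of_true ?_ (List.prefix_append [] u)
    simp only [List.replicate_zero, List.nil_append]
    induction j generalizing u with
    | zero => simp_all
    | succ j ih =>
      rcases u with _ | ⟨d, u⟩
      · exact absurd hu (by simp)
      · rw [List.replicate_succ, cons_le_cons_iff_of_bool]
        have := ih u (by simp at hu; omega)
        cases d <;> simp [this]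
  | succ k ih =>
    rcases u with _ | ⟨d, u⟩
    · simp at hu; omega
    · rw [List.replicate_succ, List.cons_append, cons_le_cons_iff_of_bool, List.cons_prefix_cons,
        ih u (by simp at hu; omega)]
      cases d <;> simp

theorem not_hasZeroRun_of_no_rotation {t w u : List Bool} {m : ℕ}
    (h2 : ∀ u, u.length = w.length → List.replicate m false <+: u → u ≤ t)
    (hw : ¬ HasRotationLE t w) (hu : u ~r w) : ¬ hasZeroRun m u := by
  rintro ⟨x, y, rfl⟩
  have hr : List.replicate m false ++ (y ++ x) ~r w := by
    refine List.IsRotated.trans ?_ hu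
    rw [← List.append_assoc, List.append_assoc x]
    exact List.isRotated_append
  exact hw ⟨_, hr, h2 _ hr.perm.length_eq (List.prefix_append _ _)⟩

theorem hasZeroRun.mono {k : ℕ} {u v : List Bool} (h : hasZeroRun k u) (huv : u <:+: v) :
    hasZeroRun k v :=
  List.IsInfix.trans h huv

theorem sum_Ico_two_pow_le (q n : ℕ) :
    ∑ p ∈ Finset.Ico q (n + 1), 2 ^ (n - p) ≤ 2 ^ (n + 1 - q) := by
  rw [Finset.sum_Ico_reflect (fun j => 2 ^ j) q le_rfl]
  refine (Nat.geomSum_lt (m := 2) (n := n + 1 - q) le_rfl ?_).le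
  intro k hk
  exact (Finset.mem_Ico.1 hk).2

open scoped Classical in
/-- The pivotal words `v = a ++ b` are sorted by the length of `b`: long `b` are prefixes of `t`,
and for short `b` the remaining letters avoid long zero runs. -/
theorem card_pivotal_le {t : List Bool} {n m q : ℕ} (hm : m ≤ n + 1)
    (h1 : ∀ u, u.length = n + 1 → u ≤ t → List.replicate m false <+: u)
    (h2 : ∀ u, u.length = n + 1 → List.replicate (m + 1) false <+: u → u ≤ t) :
    (pivotal (HasRotationLE t) n).card ≤
      q * (avoiding (m + 1) (n + 1 - m)).card + 2 ^ (n + 1 - q) := by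
  let f : ℕ → List Bool → List Bool := fun p z =>
    (List.replicate m false ++ z).drop (p + 1) ++ (List.replicate m false ++ z).take p
  have hsub : pivotal (HasRotationLE t) n ⊆
      (Finset.range q).biUnion (fun p => (avoiding (m + 1) (n + 1 - m)).image (f p)) ∪
      (Finset.Ico q (n + 1)).biUnion (fun p => (wordFinset (n - p)).image (· ++ t.take p)) := by
    intro v hv
    simp only [pivotal, Finset.mem_filter, mem_wordFinset] at hv
    obtain ⟨hl, hv0, hv1⟩ := hv
    obtain ⟨a, b, rfl, hab⟩ := hasRotationLE_cons_iff.1 hv0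
    have hr : b ++ true :: a ~r true :: (a ++ b) := isRotated_cons_iff.2 ⟨a, b, rfl, rfl⟩
    have hnle : ¬ b ++ true :: a ≤ t := fun h => hv1 ⟨_, hr, h⟩
    have hb := prefix_of_le_of_lt hab hnle
    have hrun := not_hasZeroRun_of_no_rotation (w := true :: (a ++ b)) (m := m + 1)
      (by simpa [hl] using h2) hv1 hr
    simp only [List.length_append] at hl
    rw [Finset.mem_union]
    by_cases hbq : b.length < q
    · left
      simp only [Finset.mem_biUnion, Finset.mem_range, Finset.mem_image, mem_avoiding]
      refine ⟨b.length, hbq, ?_⟩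
      by_cases hbm : m ≤ b.length
      · have hb0 : List.replicate m false <+: b := by
          refine List.prefix_of_prefix_length_le (h1 _ (by simp; omega) hab)
            (List.prefix_append _ _) (by simpa using hbm)
        obtain ⟨b', rfl⟩ := hb0
        refine ⟨b' ++ true :: a, ⟨by simp at hl ⊢; omega, fun h => hrun (h.mono ?_)⟩, ?_⟩
        · rw [List.append_assoc]
          exact (List.suffix_append _ _).isInfix
        · simp only [f]
          rw [← List.append_assoc, List.drop_append, List.take_left]
          simp
      · obtain ⟨z, hz⟩ := h1 _ (by simp; omega) hab
        have hza : z <:+ a := by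
          have hs : z <:+ b ++ false :: a := ⟨_, hz⟩
          have ha : a <:+ b ++ false :: a := by
            rw [← List.singleton_append, ← List.append_assoc]; exact List.suffix_append _ _
          refine List.suffix_of_suffix_length_le hs ha ?_
          have := congrArg List.length hz
          simp at this
          omega
        refine ⟨z, ⟨?_, fun h => hrun (h.mono ?_)⟩, ?_⟩
        · have := congrArg List.length hz
          simp at this
          omega
        · refine hza.isInfix.trans (List.IsSuffix.isInfix ?_)
          rw [← List.singleton_append, ← List.append_assoc]; exact List.suffix_append _ _
        · simp only [f]
          rw [hz, List.drop_append, List.take_left]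
          simp
    · right
      simp only [Finset.mem_biUnion, Finset.mem_Ico, Finset.mem_image, mem_wordFinset]
      exact ⟨b.length, by omega, a, by omega, by rw [← List.prefix_iff_eq_take.1 hb]⟩
  calc (pivotal (HasRotationLE t) n).card ≤ _ := Finset.card_le_card hsub
    _ ≤ _ := Finset.card_union_le _ _
    _ ≤ ∑ p ∈ Finset.range q, (avoiding (m + 1) (n + 1 - m)).card +
        ∑ p ∈ Finset.Ico q (n + 1), 2 ^ (n - p) := by
      refine add_le_add (Finset.card_biUnion_le.trans (Finset.sum_le_sum fun p _ => ?_))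
        (Finset.card_biUnion_le.trans (Finset.sum_le_sum fun p _ => ?_))
      · exact Finset.card_image_le
      · exact Finset.card_image_le.trans (card_wordFinset _).le
    _ ≤ _ := by
      rw [Finset.sum_const, Finset.card_range, smul_eq_mul]
      exact Nat.add_le_add_left (sum_Ico_two_pow_le q n) _

theorem replicate_append_true_inj {i j : ℕ} {x y : List Bool}
    (h : List.replicate i false ++ true :: x = List.replicate j false ++ true :: y) :
    i = j ∧ x = y := by
  induction i generalizing j with
  | zero => rcases j with _ | j <;> simp_all [List.replicate_succ]
  | succ i ih =>
    rcases j with _ | j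
    · simp [List.replicate_succ] at h
    · simp only [List.replicate_succ, List.cons_append, List.cons.injEq, true_and] at h
      simpa using ih h

theorem mul_card_avoiding_le_card_pivotal {t : List Bool} {k m : ℕ}
    (ht : ∀ u, u.length = k + 1 + m + 1 → (u ≤ t ↔ List.replicate k false <+: u)) :
    k * (avoiding k m).card ≤ (pivotal (HasRotationLE t) (k + 1 + m)).card := by
  rw [← Finset.card_range k, ← Finset.card_product, Finset.card_range]
  refine Finset.card_le_card_of_injOn (fun p => List.replicate p.1 false ++ true ::
    (p.2 ++ true :: List.replicate (k - 1 - p.1) false)) ?_ ?_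
  · rintro ⟨j, z⟩ hp
    simp only [Finset.coe_product, Set.mem_prod, Finset.mem_coe, Finset.mem_range,
      mem_avoiding] at hp
    obtain ⟨hj, hz, hzk⟩ := hp
    simp only [pivotal, Finset.coe_filter, mem_wordFinset, Set.mem_ofPred_eq]
    refine ⟨by simp; omega, ?_, ?_⟩
    · rw [hasRotationLE_cons_iff]
      refine ⟨List.replicate j false ++ true :: (z ++ [true]),
        List.replicate (k - 1 - j) false, by simp, (ht _ (by simp; omega)).2 ?_⟩
      refine ⟨true :: (z ++ [true]), ?_⟩
      have : List.replicate k false =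
          List.replicate (k - 1 - j) false ++ false :: List.replicate j false := by
        rw [← List.replicate_succ, ← List.replicate_add]
        congr 1
        omega
      simp [this]
    · rw [hasRotationLE_cons_iff]
      rintro ⟨a, b, hab, hle⟩
      have hl := congrArg List.length hab
      rw [ht _ (by simp at hl ⊢; omega), replicate_false_prefix_append_true_iff] at hle
      have hrun : hasZeroRun k (a ++ b) :=
        hle.isInfix.trans (List.suffix_append a b).isInfix
      rw [← hab] at hrun
      refine not_hasZeroRun_replicate_append hj ?_ hrun
      rw [hasZeroRun_append_true_iff, not_or]
      refine ⟨hzk, fun h => ?_⟩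
      have := h.le_length
      simp at this
      omega
  · rintro ⟨i, x⟩ hx ⟨j, y⟩ hy h
    simp only [Finset.coe_product, Set.mem_prod, Finset.mem_coe, Finset.mem_range,
      mem_avoiding] at hx hy
    obtain ⟨rfl, h⟩ := replicate_append_true_inj h
    simpa using h

end PivotalBounds

section Discrepancy

theorem foldr_max_le_iff {l : List ℤ} {b : ℤ} : l.foldr max 0 ≤ b ↔ 0 ≤ b ∧ ∀ x ∈ l, x ≤ b := by
  induction l with
  | nil => simp
  | cons a l ih =>
    simp only [List.foldr_cons, max_le_iff, ih, List.mem_cons, forall_eq_or_imp]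
    tauto

theorem disc_le_iff {w : List Bool} {b : ℤ} :
    disc w ≤ b ↔ ∀ u, u <+: w → |skew u| ≤ b := by
  rw [disc, foldr_max_le_iff]
  constructor
  · rintro ⟨hb, h⟩ u hu
    rcases Nat.eq_zero_or_pos u.length with h0 | hpos
    · rw [List.length_eq_zero_iff.1 h0]
      simpa [skew] using hb
    · refine h _ (List.mem_map.2 ⟨u.length - 1, ?_, ?_⟩)
      · have := hu.length_le
        rw [List.mem_range]
        omega
      · rw [Nat.sub_add_cancel hpos, ← List.prefix_iff_eq_take.1 hu]
  · intro h
    refine ⟨(abs_nonneg _).trans (h [] (List.prefix_append [] _)), ?_⟩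
    intro x hx
    obtain ⟨M, -, rfl⟩ := List.mem_map.1 hx
    exact h _ ⟨_, List.take_append_drop _ _⟩

theorem exists_prefix_flatten {L : List (List Bool)} {n : ℕ} (hL : ∀ w ∈ L, w.length ≤ n)
    {u : List Bool} (hu : u <+: L.flatten) :
    ∃ L' r, L' <+: L ∧ r.length ≤ n ∧ u = L'.flatten ++ r := by
  induction L generalizing u with
  | nil =>
    refine ⟨[], [], List.prefix_append [] _, Nat.zero_le _, ?_⟩
    simpa using hu
  | cons w L ih =>
    rw [List.flatten_cons] at hu
    rcases le_total u.length w.length with h | h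
    · refine ⟨[], u, List.prefix_append [] _, h.trans (hL w (by simp)), by simp⟩
    · obtain ⟨x, rfl⟩ := List.prefix_of_prefix_length_le (List.prefix_append _ _) hu h
      obtain ⟨L', r, h1, h2, rfl⟩ := ih (fun v hv => hL v (by simp [hv]))
        ((List.prefix_append_right_inj w).1 hu)
      exact ⟨w :: L', r, (List.cons_prefix_cons).2 ⟨rfl, h1⟩, h2, by simp⟩

theorem mem_prefix_of_le {L L' : List (List Bool)} (hL : L.Pairwise (· ≤ ·)) (h : L' <+: L)
    {u t : List Bool} (ht : t ∈ L') (hu : u ∈ L) (hut : u ≤ t) : u ∈ L' := by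
  obtain ⟨R, rfl⟩ := h
  rcases List.mem_append.1 hu with hu | hu
  · exact hu
  · have := (List.pairwise_append.1 hL).2.2 t ht u hu
    rwa [le_antisymm hut this]

theorem exists_prefix_mem_iff_le {L : List (List Bool)} (hL : L.Pairwise (· ≤ ·))
    (t : List Bool) : ∃ L', L' <+: L ∧ ∀ u, u ∈ L' ↔ u ∈ L ∧ u ≤ t := by
  induction L with
  | nil => exact ⟨[], List.prefix_append [] _, by simp⟩
  | cons w L ih =>
    rw [List.pairwise_cons] at hL
    obtain ⟨L', h1, h2⟩ := ih hL.2
    by_cases hw : w ≤ t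
    · refine ⟨w :: L', (List.cons_prefix_cons).2 ⟨rfl, h1⟩, fun u => ?_⟩
      simp only [List.mem_cons, h2]
      constructor
      · rintro (rfl | h)
        · exact ⟨Or.inl rfl, hw⟩
        · exact ⟨Or.inr h.1, h.2⟩
      · rintro ⟨rfl | h, h'⟩
        · exact Or.inl rfl
        · exact Or.inr ⟨h, h'⟩
    · refine ⟨[], List.prefix_append [] _, fun u => ?_⟩
      simp only [List.not_mem_nil, List.mem_cons, false_iff, not_and]
      rintro (rfl | h) h'
      · exact hw h'
      · exact hw ((hL.1 u h).trans h')

/-- The Lyndon words of length dividing `n` in lexicographic order. -/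
def lyndonList (n : ℕ) : List (List Bool) :=
  List.insertionSort lexLe (((List.range (n + 1)).flatMap allWords).filter
    (fun w => decide (IsLyndon w) && decide (w.length ∣ n)))

theorem lexLe_iff {u v : List Bool} : lexLe u v ↔ u ≤ v :=
  (le_iff_lt_or_eq (a := u) (b := v)).symm

theorem pairwise_lyndonList (n : ℕ) : (lyndonList n).Pairwise (· ≤ ·) := by
  have h1 : Std.Total lexLe := ⟨fun u v => by simpa only [lexLe_iff] using le_total u v⟩
  have h2 : IsTrans (List Bool) lexLe :=
    ⟨fun u v w => by simpa only [lexLe_iff] using le_trans⟩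
  exact (List.pairwise_insertionSort lexLe _).imp lexLe_iff.1

theorem mem_lyndonList {n : ℕ} (hn : 0 < n) {w : List Bool} :
    w ∈ lyndonList n ↔ IsLyndon w ∧ w.length ∣ n := by
  rw [lyndonList, (List.perm_insertionSort lexLe _).mem_iff]
  simp only [List.mem_filter, List.mem_flatMap, List.mem_range, mem_allWords,
    exists_eq_right', Bool.and_eq_true, decide_eq_true_eq, and_iff_right_iff_imp]
  exact fun h => Nat.lt_succ_of_le (Nat.le_of_dvd hn h.2)

theorem nodup_lyndonList (n : ℕ) : (lyndonList n).Nodup := by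
  rw [lyndonList, (List.perm_insertionSort lexLe _).nodup_iff]
  refine List.Nodup.filter _ ?_
  rw [List.nodup_flatMap]
  refine ⟨fun k _ => nodup_allWords k, List.nodup_range.imp ?_⟩
  intro i j hij w hi hj
  rw [mem_allWords] at hi hj
  exact hij (hi.symm.trans hj)

theorem sum_length_short_le (n : ℕ) :
    ∑ w ∈ (Finset.range (n / 2 + 1)).biUnion wordFinset, (w.length : ℤ) ≤ n * 2 ^ (n / 2) := by
  rw [Finset.sum_biUnion]
  · calc ∑ d ∈ Finset.range (n / 2 + 1), ∑ w ∈ wordFinset d, (w.length : ℤ)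
        ≤ ∑ d ∈ Finset.range (n / 2 + 1), ((n / 2 : ℕ) : ℤ) * 2 ^ d := by
          refine Finset.sum_le_sum fun d hd => ?_
          rw [Finset.sum_congr rfl fun w hw => by rw [mem_wordFinset.1 hw], Finset.sum_const,
            card_wordFinset, nsmul_eq_mul, mul_comm]
          push_cast
          have : d ≤ n / 2 := Nat.lt_succ_iff.1 (Finset.mem_range.1 hd)
          gcongr
          exact_mod_cast this
      _ = ((n / 2 : ℕ) : ℤ) * ((∑ d ∈ Finset.range (n / 2 + 1), 2 ^ d : ℕ) : ℤ) := by
          rw [← Finset.mul_sum]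
          push_cast
          rfl
      _ ≤ ((n / 2 : ℕ) : ℤ) * ((2 ^ (n / 2 + 1) : ℕ) : ℤ) := by
          gcongr
          exact (Nat.geomSum_lt (m := 2) (n := n / 2 + 1) le_rfl (by simp)).le
      _ = ((n / 2 : ℕ) * 2 : ℕ) * 2 ^ (n / 2) := by
          push_cast
          ring
      _ ≤ n * 2 ^ (n / 2) := by
          gcongr
          omega
  · intro i _ j _ hij
    rw [Function.onFun, Finset.disjoint_left]
    intro w hi hj
    rw [mem_wordFinset] at hi hj
    exact hij (hi.symm.trans hj)

theorem abs_skew_flatten_sub_le {n : ℕ} (hn : 0 < n) {L : List (List Bool)}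
    (hL : L <+: lyndonList n) :
    |skew L.flatten - ∑ w ∈ wordFinset n with w ∈ L, skew w| ≤ n * 2 ^ (n / 2) := by
  have hnd : L.Nodup := (nodup_lyndonList n).sublist hL.sublist
  have h1 : skew L.flatten = ∑ w ∈ L.toFinset, skew w := by
    rw [skew_flatten, List.sum_toFinset _ hnd]
  have h2 : {w ∈ wordFinset n | w ∈ L} ⊆ L.toFinset := by
    intro w hw
    simpa using (Finset.mem_filter.1 hw).2
  rw [h1, ← Finset.sum_sdiff h2, add_sub_cancel_right]
  refine (Finset.abs_sum_le_sum_abs _ _).trans ?_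
  refine (Finset.sum_le_sum fun w _ => abs_skew_le w).trans ?_
  refine (Finset.sum_le_sum_of_subset_of_nonneg ?_ fun _ _ _ => by positivity).trans
    (sum_length_short_le n)
  intro w hw
  simp only [Finset.mem_sdiff, List.mem_toFinset, Finset.mem_filter, mem_wordFinset,
    not_and] at hw
  have hd := ((mem_lyndonList hn).1 (hL.subset hw.1)).2
  have hne : w.length ≠ n := fun h => hw.2 h hw.1
  simp only [Finset.mem_biUnion, Finset.mem_range, mem_wordFinset, exists_eq_right']
  obtain ⟨c, hc⟩ := hd
  have hc2 : 2 ≤ c := by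
    rcases c with _ | _ | c
    · omega
    · simp at hc; omega
    · omega
  rw [Nat.lt_succ_iff, Nat.le_div_iff_mul_le two_pos]
  calc w.length * 2 ≤ w.length * c := Nat.mul_le_mul_left _ hc2
    _ = n := hc.symm

open scoped Classical in
theorem sum_skew_prefix_eq {n : ℕ} (hn : 0 < n) {L : List (List Bool)}
    (hL : L <+: lyndonList n) :
    (∑ w ∈ wordFinset n with w ∈ L, skew w) = 0 ∨ ∃ t, t.length = n ∧
      ∑ w ∈ wordFinset n with w ∈ L, skew w =
        ∑ w ∈ wordFinset n with IsLyndon w ∧ w ≤ t, skew w := by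
  rcases Finset.eq_empty_or_nonempty {w ∈ wordFinset n | w ∈ L} with h | h
  · left
    rw [h, Finset.sum_empty]
  · right
    obtain ⟨t, ht, hmax⟩ := Finset.exists_max_image _ id h
    simp only [Finset.mem_filter, mem_wordFinset] at ht
    refine ⟨t, ht.1, Finset.sum_congr (Finset.ext fun w => ?_) fun _ _ => rfl⟩
    simp only [Finset.mem_filter, mem_wordFinset]
    refine and_congr_right fun hw => ⟨fun hwL => ?_, fun h => ?_⟩
    · exact ⟨((mem_lyndonList hn).1 (hL.subset hwL)).1, hmax w (by simp [hw, hwL])⟩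
    · exact mem_prefix_of_le (pairwise_lyndonList n) hL ht.2
        ((mem_lyndonList hn).2 ⟨h.1, by rw [hw]⟩) h.2

theorem disc_LWord_le {n P : ℕ}
    (hP : ∀ t, t.length = n + 1 → (pivotal (HasRotationLE t) n).card ≤ P) :
    disc (LWord (n + 1)) ≤ P + 4 * ((n + 1 : ℕ) * 2 ^ ((n + 1) / 2)) := by
  rw [disc_le_iff]
  intro u hu
  have hlen : ∀ w ∈ lyndonList (n + 1), w.length ≤ n + 1 := fun w hw =>
    Nat.le_of_dvd n.succ_pos ((mem_lyndonList n.succ_pos).1 hw).2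
  obtain ⟨L, r, hL, hr, rfl⟩ := exists_prefix_flatten (L := lyndonList (n + 1)) hlen hu
  have h1 := abs_skew_flatten_sub_le (n := n + 1) n.succ_pos hL
  have h2 : |∑ w ∈ wordFinset (n + 1) with w ∈ L, skew w| ≤ P + 2 * 2 ^ ((n + 1) / 2) := by
    rcases sum_skew_prefix_eq n.succ_pos hL with h | ⟨t, ht, h⟩
    · rw [h, abs_zero]
      positivity
    · have h3 := abs_sum_lyndon_sub_card_pivotal_le t n
      have h4 : ((imprimitive (n + 1)).card : ℤ) ≤ 2 * 2 ^ ((n + 1) / 2) := by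
        have := card_imprimitive_le (n + 1)
        rw [pow_succ'] at this
        exact_mod_cast this
      have h5 : ((pivotal (HasRotationLE t) n).card : ℤ) ≤ P := mod_cast hP t ht
      rw [h]
      rw [abs_le] at h3 ⊢
      constructor <;> linarith [h3.1, h3.2, Int.natCast_nonneg (pivotal (HasRotationLE t) n).card]
  have h6 := abs_skew_le r
  have h7 : (r.length : ℤ) ≤ (n + 1 : ℕ) := mod_cast hr
  have h8 : (1 : ℤ) ≤ 2 ^ ((n + 1) / 2) := one_le_pow₀ (by norm_num)
  have h9 : (1 : ℤ) ≤ (n + 1 : ℕ) := by push_cast; linarith [Int.natCast_nonneg n]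
  have h10 : (2 : ℤ) ^ ((n + 1) / 2) ≤ (n + 1 : ℕ) * 2 ^ ((n + 1) / 2) :=
    le_mul_of_one_le_left (by positivity) h9
  have h11 : ((n + 1 : ℕ) : ℤ) ≤ (n + 1 : ℕ) * 2 ^ ((n + 1) / 2) :=
    le_mul_of_one_le_right (by positivity) h8
  rw [skew_append]
  rw [abs_le] at h1 h2 h6 ⊢
  constructor <;> linarith [h1.1, h1.2, h2.1, h2.2, h6.1, h6.2]

theorem card_pivotal_le_disc_LWord (t : List Bool) (n : ℕ) :
    ((pivotal (HasRotationLE t) n).card : ℤ) ≤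
      disc (LWord (n + 1)) + 4 * ((n + 1 : ℕ) * 2 ^ ((n + 1) / 2)) := by
  obtain ⟨L, hL, hmem⟩ := exists_prefix_mem_iff_le (pairwise_lyndonList (n + 1)) t
  have h1 := abs_skew_flatten_sub_le (n := n + 1) n.succ_pos hL
  have h2 : L.flatten <+: LWord (n + 1) := by
    obtain ⟨R, hR⟩ := hL
    exact ⟨R.flatten, by rw [← List.flatten_append, hR]; rfl⟩
  have h3 := disc_le_iff.1 le_rfl _ h2
  have h4 := abs_sum_lyndon_sub_card_pivotal_le t n
  have h5 : ((imprimitive (n + 1)).card : ℤ) ≤ 2 * 2 ^ ((n + 1) / 2) := by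
    have := card_imprimitive_le (n + 1)
    rw [pow_succ'] at this
    exact_mod_cast this
  have h6 : ∑ w ∈ wordFinset (n + 1) with w ∈ L, skew w =
      ∑ w ∈ wordFinset (n + 1) with IsLyndon w ∧ w ≤ t, skew w := by
    refine Finset.sum_congr (Finset.ext fun w => ?_) fun _ _ => rfl
    simp only [Finset.mem_filter, mem_wordFinset, hmem, mem_lyndonList n.succ_pos]
    refine and_congr_right fun hw => ?_
    simp [hw]
  rw [h6] at h1
  have h9 : (1 : ℤ) ≤ (n + 1 : ℕ) := by push_cast; linarith [Int.natCast_nonneg n]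
  have h10 : (2 : ℤ) ^ ((n + 1) / 2) ≤ (n + 1 : ℕ) * 2 ^ ((n + 1) / 2) :=
    le_mul_of_one_le_left (by positivity) h9
  rw [abs_le] at h1 h3 h4
  linarith [h1.1, h1.2, h3.1, h3.2, h4.1, h4.2]

end Discrepancy

section Asymptotics

theorem mul_sq_le_two_pow {n : ℕ} (hn : 64 ≤ n) : 256 * n ^ 2 ≤ 2 ^ (n - n / 2) := by
  have key : ∀ h, 32 ≤ h → 256 * (2 * h + 1) ^ 2 ≤ 2 ^ h := by
    intro h hh
    induction h, hh using Nat.le_induction with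
    | base => norm_num
    | succ h hh ih =>
      rw [pow_succ 2 h]
      nlinarith
  calc 256 * n ^ 2 ≤ 256 * (2 * (n / 2) + 1) ^ 2 := by
        gcongr
        omega
    _ ≤ 2 ^ (n / 2) := key _ (by omega)
    _ ≤ 2 ^ (n - n / 2) := Nat.pow_le_pow_right two_pos (by omega)

theorem one_le_log_of_three_le {n : ℕ} (hn : 3 ≤ n) : 1 ≤ Real.log n := by
  rw [Real.le_log_iff_exp_le (by positivity)]
  have h1 := Real.exp_one_lt_d9
  have h2 : (3 : ℝ) ≤ n := mod_cast hn
  linarith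

theorem error_le {n : ℕ} (hn : 64 ≤ n) :
    (4 * (n * 2 ^ (n / 2)) : ℝ) ≤ 1 / 64 * (2 ^ n * Real.log n / n) := by
  have hpos : (0 : ℝ) < n := by
    have : 0 < n := by omega
    exact_mod_cast this
  have h1 : (256 * n ^ 2 : ℝ) ≤ 2 ^ (n - n / 2) := mod_cast mul_sq_le_two_pow hn
  have h2 : (2 : ℝ) ^ n = 2 ^ (n - n / 2) * 2 ^ (n / 2) := by
    rw [← pow_add, Nat.sub_add_cancel (Nat.div_le_self n 2)]
  have h3 := one_le_log_of_three_le (n := n) (by omega)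
  have h4 : (4 * (n * 2 ^ (n / 2)) : ℝ) ≤ 1 / 64 * (2 ^ n / n) := by
    rw [mul_div_assoc', le_div_iff₀ hpos, h2]
    have := mul_le_mul_of_nonneg_right h1 (by positivity : (0 : ℝ) ≤ 2 ^ (n / 2))
    linarith
  refine h4.trans ?_
  gcongr
  exact le_mul_of_one_le_right (by positivity) h3

theorem card_avoiding_sub_le {n m : ℕ} (hn : 0 < n) (hm : m ≤ n) :
    ((avoiding (m + 1) (n - m)).card : ℝ) ≤ 8 * (2 ^ n / n) := by
  have hpos : (0 : ℝ) < n := mod_cast hn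
  have h2 : (2 : ℝ) ^ (n - m) * 2 ^ m = 2 ^ n := by
    rw [← pow_add, Nat.sub_add_cancel hm]
  by_cases h : 4 * m + 4 ≤ n
  · obtain ⟨M, hM⟩ : ∃ M, n - m = m + 1 + M := ⟨n - m - (m + 1), by omega⟩
    have hMn : (n : ℝ) ≤ 2 * M := by
      have : n ≤ 2 * M := by omega
      exact_mod_cast this
    set y : ℝ := n / 2 ^ (m + 3) with hy
    have hypos : 0 < y := by positivity
    have h3 : (1 - 1 / 2 ^ (m + 2) : ℝ) ^ M ≤ 1 / y := by
      have h4 : (0 : ℝ) ≤ 1 - 1 / 2 ^ (m + 2) := by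
        rw [sub_nonneg, div_le_one (by positivity)]
        exact one_le_pow₀ (by norm_num)
      calc (1 - 1 / 2 ^ (m + 2) : ℝ) ^ M ≤ Real.exp (-(1 / 2 ^ (m + 2))) ^ M := by
            gcongr
            exact Real.one_sub_le_exp_neg _
        _ = Real.exp (-(M / 2 ^ (m + 2))) := by
            rw [← Real.exp_nat_mul]
            congr 1
            ring
        _ ≤ Real.exp (-y) := by
            gcongr
            rw [hy, pow_succ 2 (m + 2), div_le_div_iff₀ (by positivity) (by positivity)]
            have : (0 : ℝ) < 2 ^ (m + 2) := by positivity
            nlinarith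
        _ ≤ 1 / y := by
            rw [Real.exp_neg, ← one_div]
            gcongr
            linarith [Real.add_one_le_exp y]
    have h5 := card_avoiding_le_mul_pow m M
    rw [← hM] at h5
    calc ((avoiding (m + 1) (n - m)).card : ℝ) ≤ 2 ^ (n - m) * (1 - 1 / 2 ^ (m + 2)) ^ M := h5
      _ ≤ 2 ^ (n - m) * (1 / y) := by gcongr
      _ = 8 * ((2 ^ (n - m) * 2 ^ m) / n) := by
        rw [hy, one_div_div]
        ring
      _ = 8 * (2 ^ n / n) := by rw [h2]
  · have h3 : n ≤ 8 * 2 ^ m := by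
      have := Nat.lt_two_pow_self (n := m)
      omega
    have h4 : (n : ℝ) ≤ 8 * 2 ^ m := mod_cast h3
    calc ((avoiding (m + 1) (n - m)).card : ℝ) ≤ 2 ^ (n - m) := mod_cast card_avoiding_le _ _
      _ ≤ 8 * (2 ^ n / n) := by
        rw [mul_div_assoc', le_div_iff₀ hpos, ← h2]
        have : (0 : ℝ) < 2 ^ (n - m) := by positivity
        nlinarith

theorem card_pivotal_le_log {t : List Bool} {n : ℕ} (hn : 2 ≤ n) (ht : t.length = n + 1) :
    ((pivotal (HasRotationLE t) n).card : ℝ) ≤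
      36 * (2 ^ (n + 1) * Real.log (n + 1 : ℕ) / (n + 1 : ℕ)) := by
  obtain ⟨m, hm, h1, h2⟩ := exists_leading_zeros t
  rw [ht] at hm h1 h2
  set ν := n + 1 with hν
  have hpos : (0 : ℝ) < ν := by positivity
  set q := Nat.clog 2 ν with hq
  have hq1 : ν ≤ 2 ^ q := Nat.le_pow_clog one_lt_two ν
  have hq2 : 2 ^ (q - 1) < ν := Nat.pow_pred_clog_lt_self one_lt_two (by omega)
  have hq0 : 0 < q := Nat.clog_pos one_lt_two (by omega)
  have hqν : q ≤ ν := Nat.clog_le_of_le_pow Nat.lt_two_pow_self.le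
  have h3 : ((pivotal (HasRotationLE t) n).card : ℝ) ≤
      q * (avoiding (m + 1) (ν - m)).card + 2 ^ (ν - q) :=
    mod_cast card_pivotal_le hm h1 h2
  have h4 := card_avoiding_sub_le (n := ν) (by omega) hm
  have h5 : (2 : ℝ) ^ (ν - q) ≤ 2 ^ ν / ν := by
    have h6 : (2 : ℝ) ^ (ν - q) * 2 ^ q = 2 ^ ν := by rw [← pow_add, Nat.sub_add_cancel hqν]
    rw [le_div_iff₀ hpos, ← h6]
    gcongr
    exact_mod_cast hq1
  have hlog := one_le_log_of_three_le (n := ν) (by omega)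
  have hq3 : (q : ℝ) ≤ 4 * Real.log ν := by
    have h7 : ((q - 1 : ℕ) : ℝ) * Real.log 2 ≤ Real.log ν := by
      rw [← Real.log_pow]
      exact Real.log_le_log (by positivity) (mod_cast hq2.le)
    rw [Nat.cast_sub hq0, Nat.cast_one] at h7
    have h8 := Real.log_two_gt_d9
    have h9 : (1 : ℝ) ≤ q := mod_cast hq0
    nlinarith
  have h9 : (1 : ℝ) ≤ q := mod_cast hq0
  have hX : (0 : ℝ) < 2 ^ ν / ν := by positivity
  calc ((pivotal (HasRotationLE t) n).card : ℝ)
      ≤ q * (avoiding (m + 1) (ν - m)).card + 2 ^ (ν - q) := h3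
    _ ≤ q * (8 * (2 ^ ν / ν)) + 2 ^ ν / ν := by gcongr
    _ ≤ 9 * q * (2 ^ ν / ν) := by nlinarith
    _ ≤ 9 * (4 * Real.log ν) * (2 ^ ν / ν) := by gcongr
    _ = _ := by ring

theorem exists_log_le_card_pivotal {n : ℕ} (hn : 64 ≤ n + 1) :
    ∃ t, 1 / 32 * (2 ^ (n + 1) * Real.log (n + 1 : ℕ) / (n + 1 : ℕ)) ≤
      ((pivotal (HasRotationLE t) n).card : ℝ) := by
  set K := Nat.log 2 (n + 1) + 1 with hK
  have hν0 : n + 1 ≠ 0 := by omega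
  have hlow : n + 1 < 2 ^ K := Nat.lt_pow_succ_log_self one_lt_two _
  have hupp : 2 ^ K ≤ 2 * (n + 1) := by
    rw [hK, pow_succ, mul_comm]
    exact Nat.mul_le_mul_left _ (Nat.pow_log_le_self 2 hν0)
  have hKn : K + 2 < n + 1 := by
    have h1 : Nat.log 2 (n + 1) < n + 1 - 4 := by
      refine Nat.log_lt_of_lt_pow hν0 ?_
      calc n + 1 < 256 * (n + 1) ^ 2 := by nlinarith
        _ ≤ 2 ^ (n + 1 - (n + 1) / 2) := mul_sq_le_two_pow hn
        _ ≤ 2 ^ (n + 1 - 4) := Nat.pow_le_pow_right two_pos (by omega)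
    omega
  obtain ⟨m, hm⟩ : ∃ m, n = K + 1 + 1 + m := ⟨n - (K + 2), by omega⟩
  refine ⟨List.replicate (K + 1) false ++ List.replicate (m + 2) true, ?_⟩
  have h1 := mul_card_avoiding_le_card_pivotal
    (t := List.replicate (K + 1) false ++ List.replicate (m + 2) true) (k := K + 1) (m := m)
    fun u hu => le_replicate_append_iff _ _ u (by omega)
  rw [← hm] at h1
  have h2 := two_pow_mul_le_card_avoiding K m
  have h3 : 2 ^ m ≤ 2 * (avoiding (K + 1) m).card := by
    have h4 : 2 * m ≤ 2 ^ (K + 1) := by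
      rw [pow_succ]
      omega
    have h5 : 2 * m * 2 ^ m ≤ 2 ^ (K + 1) * 2 ^ m := Nat.mul_le_mul_right _ h4
    refine Nat.le_of_mul_le_mul_left ?_ (show 0 < 2 ^ (K + 1) by positivity)
    linarith
  have h6 : ((K : ℝ) + 1) * (avoiding (K + 1) m).card ≤
      (pivotal (HasRotationLE (List.replicate (K + 1) false ++ List.replicate (m + 2) true))
        n).card := mod_cast h1
  have h7 : (2 : ℝ) ^ m ≤ 2 * (avoiding (K + 1) m).card := mod_cast h3
  have h8 : Real.log (n + 1 : ℕ) ≤ K + 1 := by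
    have h9 : Real.log (n + 1 : ℕ) ≤ Real.log ((2 : ℝ) ^ K) :=
      Real.log_le_log (by positivity) (mod_cast hlow.le)
    rw [Real.log_pow] at h9
    have h10 := Real.log_two_lt_d9
    have h11 : (0 : ℝ) ≤ K := by positivity
    nlinarith
  refine le_trans ?_ h6
  have hpow : (2 : ℝ) ^ (n + 1) = 2 ^ m * (8 * 2 ^ K) := by
    rw [show n + 1 = m + 3 + K by omega, pow_add, pow_add]
    ring
  have h12 : (2 : ℝ) ^ (n + 1) / (n + 1 : ℕ) ≤ 16 * 2 ^ m := by
    rw [div_le_iff₀ (by positivity), hpow]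
    have h13 : (2 : ℝ) ^ K ≤ 2 * (n + 1 : ℕ) := mod_cast hupp
    have h14 : (0 : ℝ) < 2 ^ m := by positivity
    nlinarith
  have hlog := one_le_log_of_three_le (n := n + 1) (by omega)
  calc 1 / 32 * ((2 : ℝ) ^ (n + 1) * Real.log (n + 1 : ℕ) / (n + 1 : ℕ))
      = 1 / 32 * (Real.log (n + 1 : ℕ) * (2 ^ (n + 1) / (n + 1 : ℕ))) := by ring
    _ ≤ 1 / 32 * ((K + 1) * (16 * (2 * (avoiding (K + 1) m).card))) := by
      gcongr
      exact h12.trans (by gcongr)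
    _ = (K + 1) * (avoiding (K + 1) m).card := by ring

end Asymptotics

/-- The discrepancy of the lexicographically least binary de Bruijn
sequence of order `n` is `Θ(2^n · log n / n)`. -/
theorem disc_LWord_asymptotics :
    ∃ c > (0 : ℝ), ∃ C > (0 : ℝ), ∃ N : ℕ, ∀ n : ℕ, N ≤ n →
      c * 2 ^ n * Real.log n / n ≤ (disc (LWord n) : ℝ) ∧
      (disc (LWord n) : ℝ) ≤ C * 2 ^ n * Real.log n / n := by
  refine ⟨1 / 64, by norm_num, 37, by norm_num, 64, fun n hn => ?_⟩
  obtain ⟨n, rfl⟩ : ∃ k, n = k + 1 := ⟨n - 1, by omega⟩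
  have herr := error_le hn
  set X : ℝ := 2 ^ (n + 1) * Real.log (n + 1 : ℕ) / (n + 1 : ℕ) with hX
  have hlog := one_le_log_of_three_le (n := n + 1) (by omega)
  have hXpos : 0 < X := by positivity
  constructor
  · obtain ⟨t, ht⟩ := exists_log_le_card_pivotal hn
    have h1 : ((pivotal (HasRotationLE t) n).card : ℝ) ≤
        disc (LWord (n + 1)) + 4 * ((n + 1 : ℕ) * 2 ^ ((n + 1) / 2)) :=
      mod_cast card_pivotal_le_disc_LWord t n
    rw [← hX] at ht
    calc 1 / 64 * 2 ^ (n + 1) * Real.log (n + 1 : ℕ) / (n + 1 : ℕ) = 1 / 64 * X := by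
          rw [hX]
          ring
      _ ≤ disc (LWord (n + 1)) := by linarith
  · have h1 : (disc (LWord (n + 1)) : ℝ) ≤
        (⌊36 * X⌋₊ : ℝ) + 4 * ((n + 1 : ℕ) * 2 ^ ((n + 1) / 2)) :=
      mod_cast disc_LWord_le fun t ht => Nat.le_floor (card_pivotal_le_log (by omega) ht)
    have h2 : (⌊36 * X⌋₊ : ℝ) ≤ 36 * X := Nat.floor_le (by positivity)
    calc (disc (LWord (n + 1)) : ℝ) ≤ 37 * X := by linarith
      _ = 37 * 2 ^ (n + 1) * Real.log (n + 1 : ℕ) / (n + 1 : ℕ) := by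
          rw [hX]
          ring
end

section
/- Fix an integer k ≥ 2. Then β_k(j) = 0 for all 0 ≤ j < k, and for all n ≥ k, β_k(n) = Σ_{j=1}^{k} [ (j−2) · α_k(n−j) + β_k(n−j) ]. -/
/-- The sum of `f` over all binary words of length `n`. -/
def wordSum (f : List Bool → ℤ) (n : ℕ) : ℤ := ((allWords n).map f).sum

theorem length_of_mem_allWords {n : ℕ} {w : List Bool} (hw : w ∈ allWords n) : w.length = n := by
  induction n generalizing w with
  | zero => simp_all [allWords]
  | succ n ih =>
    simp only [allWords, List.mem_flatMap, List.mem_cons, List.not_mem_nil, or_false] at hw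
    obtain ⟨u, hu, rfl | rfl⟩ := hw <;> simp [ih hu]

theorem wordSum_congr {f g : List Bool → ℤ} {n : ℕ}
    (h : ∀ w : List Bool, w.length = n → f w = g w) : wordSum f n = wordSum g n := by
  unfold wordSum
  rw [List.map_congr_left fun w hw => h w (length_of_mem_allWords hw)]

theorem wordSum_add (f g : List Bool → ℤ) (n : ℕ) :
    wordSum (fun w => f w + g w) n = wordSum f n + wordSum g n :=
  List.sum_map_add

theorem wordSum_const_mul (c : ℤ) (f : List Bool → ℤ) (n : ℕ) :
    wordSum (fun w => c * f w) n = c * wordSum f n :=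
  List.sum_map_mul_left _ _ _

theorem wordSum_zero (n : ℕ) : wordSum (fun _ => 0) n = 0 := by
  simp [wordSum]

theorem wordSum_succ (f : List Bool → ℤ) (n : ℕ) :
    wordSum f (n + 1) =
      wordSum (fun w => f (w ++ [false])) n + wordSum (fun w => f (w ++ [true])) n := by
  rw [← wordSum_add]
  simp only [wordSum, allWords]
  induction allWords n with
  | nil => simp
  | cons a l ih => simp_all [add_assoc]

/-- Classify the words of length `n + m` by the last `true` among their last `m` letters. -/
theorem wordSum_add_length (f : List Bool → ℤ) (n m : ℕ) :
    wordSum f (n + m) =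
      ∑ i ∈ Finset.range m,
        wordSum (fun u => f (u ++ true :: List.replicate i false)) (n + m - (i + 1)) +
      wordSum (fun u => f (u ++ List.replicate m false)) n := by
  induction m generalizing n with
  | zero => simp
  | succ m ih =>
    rw [show n + (m + 1) = n + 1 + m by ring, ih, wordSum_succ, Finset.sum_range_succ,
      show n + 1 + m - (m + 1) = n by lia]
    simp only [List.append_assoc, List.singleton_append, ← List.replicate_succ]
    ring

theorem hasZeroRun_append_true_replicate {k i : ℕ} (hi : i < k) (u : List Bool) :
    hasZeroRun k (u ++ true :: List.replicate i false) ↔ hasZeroRun k u := by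
  refine ⟨?_, fun h => h.trans (List.infix_append' [] u _)⟩
  rintro ⟨s, t, h⟩
  rcases List.append_eq_append_iff.1 h with ⟨c, hc, -⟩ | ⟨c, hc, hct⟩
  · exact ⟨s, c, hc.symm⟩
  rcases c with _ | ⟨b, c⟩
  · exact ⟨s, [], by simpa using hc⟩
  obtain ⟨rfl, hct⟩ : true = b ∧ List.replicate i false = c ++ t := by simpa using hct
  have hlen : i = c.length + t.length := by simpa using congrArg List.length hct
  rcases List.append_eq_append_iff.1 hc with ⟨a, -, ha⟩ | ⟨a, -, ha⟩
  · have : true ∈ List.replicate k false := by simp [ha]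
    simp at this
  · have hl := congrArg List.length ha
    simp only [List.length_cons, List.length_append, List.length_replicate] at hl
    obtain rfl : a = [] := List.eq_nil_of_length_eq_zero (by lia)
    have : true ∈ List.replicate k false := by
      rw [List.nil_append] at ha
      simp [← ha]
    simp at this

theorem not_hasZeroRun_of_length_lt {k : ℕ} {w : List Bool} (h : w.length < k) :
    ¬ hasZeroRun k w := fun hw => by
  simpa using hw.length_le.trans_lt h

theorem skew_true_replicate (i : ℕ) : skew (true :: List.replicate i false) = (i : ℤ) - 1 := by
  simp [skew]
  ring

theorem sum_map_filter_allWords (k n : ℕ) (f : List Bool → ℤ) :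
    (((allWords n).filter (fun w => !decide (hasZeroRun k w))).map f).sum =
      wordSum (fun w => if hasZeroRun k w then 0 else f w) n := by
  unfold wordSum
  induction allWords n with
  | nil => simp
  | cons a l ih => by_cases h : hasZeroRun k a <;> simp [h, ih]

theorem beta_eq_wordSum (k n : ℕ) :
    beta k n = wordSum (fun w => if hasZeroRun k w then 0 else skew w) n :=
  sum_map_filter_allWords k n skew

theorem alpha_eq_wordSum (k n : ℕ) :
    (alpha k n : ℤ) = wordSum (fun w => if hasZeroRun k w then 0 else 1) n := by
  rw [← sum_map_filter_allWords]
  simp [alpha]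

theorem wordSum_skew (n : ℕ) : wordSum skew n = 0 := by
  induction n with
  | zero => simp [wordSum, allWords, skew]
  | succ n ih =>
    rw [wordSum_succ, ← wordSum_add,
      wordSum_congr (g := fun w => 2 * skew w) fun w _ => by simp [skew]; ring,
      wordSum_const_mul, ih, mul_zero]

/-- Base values and recurrence for `β_k`. -/
theorem beta_recurrence (k : ℕ) (hk : 2 ≤ k) :
    (∀ j : ℕ, j < k → beta k j = 0) ∧
    (∀ n : ℕ, k ≤ n →
      beta k n = ∑ j ∈ Finset.Icc 1 k,
        (((j : ℤ) - 2) * (alpha k (n - j) : ℤ) + beta k (n - j))) := by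
  refine ⟨fun j hj => ?_, fun n hn => ?_⟩
  · rw [beta_eq_wordSum, ← wordSum_skew j]
    exact wordSum_congr fun w hw => if_neg (not_hasZeroRun_of_length_lt (hw ▸ hj))
  · obtain ⟨m, rfl⟩ := Nat.exists_eq_add_of_le' hn
    have hrun (u : List Bool) : hasZeroRun k (u ++ List.replicate k false) :=
      (List.suffix_append u _).isInfix
    rw [beta_eq_wordSum, wordSum_add_length]
    simp only [hrun, if_true, wordSum_zero, add_zero]
    rw [← Finset.Ico_add_one_right_eq_Icc, Finset.sum_Ico_eq_sum_range, Nat.add_sub_cancel]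
    refine Finset.sum_congr rfl fun i hi => ?_
    rw [Nat.add_comm 1 i, alpha_eq_wordSum, beta_eq_wordSum, ← wordSum_const_mul, ← wordSum_add]
    refine wordSum_congr fun u _ => ?_
    rw [skew_append, skew_true_replicate]
    simp only [hasZeroRun_append_true_replicate (Finset.mem_range.1 hi)]
    split_ifs
    · simp
    · push_cast
      ring
end
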